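/- arXiv:2412.09738 — 3 statements merged into one kernel-verified Lean document; each statement's English description precedes it below -/
import Mathlib

section
/- Let a, b : ℕ → ℝ, let S be a finite set of primes, and let M > 0 be such that |a(p)| ≤ M and |b(p)| ≤ M for every prime p ∉ S. Suppose there exist constants c > 0 and C > 0 such that for all sufficiently large x: |∑_{p ≤ x, p prime} (log p)·a(p)² − x| ≤ C·x·e^{−c·√(log x)}, |∑_{p ≤ x, p prime} (log p)·b(p)² − x| ≤ C·x·e^{−c·√(log x)}, and |∑_{p ≤ x, p prime} (log p)·a(p)·b(p)| ≤ C·x·e^{−c·√(log x)}. Then ∑_{p ≤ x, p prime} (a(p) + b(p))² = 2·x/log x + o(x/log x) as x → ∞. -/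
open Filter Asymptotics

/-- The finite set of primes `p ≤ x` (for a real `x`). -/
noncomputable def primesUpTo (x : ℝ) : Finset ℕ :=
  (Finset.Iic ⌊x⌋₊).filter Nat.Prime

lemma aux_T (a b : ℕ → ℝ) (c C : ℝ) (hc : 0 < c)
    (hPNTa : ∀ᶠ x : ℝ in atTop,
      |(∑ p ∈ primesUpTo x, Real.log p * (a p) ^ 2) - x| ≤
        C * x * Real.exp (-c * Real.sqrt (Real.log x)))
    (hPNTb : ∀ᶠ x : ℝ in atTop,
      |(∑ p ∈ primesUpTo x, Real.log p * (b p) ^ 2) - x| ≤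
        C * x * Real.exp (-c * Real.sqrt (Real.log x)))
    (hPNTab : ∀ᶠ x : ℝ in atTop,
      |∑ p ∈ primesUpTo x, Real.log p * (a p * b p)| ≤
        C * x * Real.exp (-c * Real.sqrt (Real.log x))) :
    (fun x : ℝ => (∑ p ∈ primesUpTo x, Real.log p * (a p + b p) ^ 2) - 2 * x)
      =o[atTop] (fun x : ℝ => x) := by
  have hE : (fun x : ℝ => C * x * Real.exp (-c * Real.sqrt (Real.log x)))
      =o[atTop] (fun x : ℝ => x) := by
    have h1 : Tendsto (fun x : ℝ => c * Real.sqrt (Real.log x)) atTop atTop :=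
      (Real.tendsto_sqrt_atTop.comp Real.tendsto_log_atTop).const_mul_atTop hc
    have h2 : Tendsto (fun x : ℝ => Real.exp (-c * Real.sqrt (Real.log x))) atTop (nhds 0) := by
      have := Real.tendsto_exp_neg_atTop_nhds_zero.comp h1
      refine this.congr fun x => ?_
      simp [Function.comp]
    have h3 := (isLittleO_one_iff ℝ).2 h2
    have h4 := ((isBigO_refl (fun x : ℝ => x) atTop).const_mul_left C).mul_isLittleO h3
    simpa using h4
  have key : ∀ f : ℝ → ℝ, (∀ᶠ x : ℝ in atTop, |f x| ≤
        C * x * Real.exp (-c * Real.sqrt (Real.log x))) → f =o[atTop] (fun x : ℝ => x) := by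
    intro f hf
    refine IsBigO.trans_isLittleO (IsBigO.of_bound 1 ?_) hE
    filter_upwards [hf] with x hx
    rw [one_mul, Real.norm_eq_abs, Real.norm_eq_abs]
    exact hx.trans (le_abs_self _)
  refine (((key _ hPNTa).add (key _ hPNTb)).add ((key _ hPNTab).const_mul_left 2)).congr_left ?_
  intro x
  have : ∑ p ∈ primesUpTo x, Real.log p * (a p + b p) ^ 2
      = ∑ p ∈ primesUpTo x, Real.log p * (a p) ^ 2 + ∑ p ∈ primesUpTo x, Real.log p * (b p) ^ 2
        + 2 * ∑ p ∈ primesUpTo x, Real.log p * (a p * b p) := by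
    rw [Finset.mul_sum, ← Finset.sum_add_distrib, ← Finset.sum_add_distrib]
    exact Finset.sum_congr rfl fun p _ => by ring
  rw [this]; ring

lemma aux_theta (x : ℝ) : ∑ p ∈ primesUpTo x, Real.log p = Chebyshev.theta x := by
  rw [Chebyshev.theta_eq_sum_Icc]
  rfl

lemma aux_pi (x : ℝ) : ((primesUpTo x).card : ℝ) = (Nat.primeCounting ⌊x⌋₊ : ℝ) := by
  rw [Nat.primeCounting, Nat.primeCounting', Nat.count_eq_card_filter_range, primesUpTo]
  congr 2
  ext p
  simp [Nat.lt_succ_iff]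

lemma aux_D (g : ℕ → ℝ) (hg : ∀ p, 0 ≤ g p) (S : Finset ℕ) (K : ℝ)
    (hK : ∀ p : ℕ, Nat.Prime p → p ∉ S → g p ≤ K) (hK0 : 0 ≤ K) :
    (fun x : ℝ => (∑ p ∈ primesUpTo x, g p) * Real.log x - ∑ p ∈ primesUpTo x, Real.log p * g p)
      =o[atTop] (fun x : ℝ => x) := by
  have hlog := Real.isLittleO_log_id_atTop
  have hpi : (fun x : ℝ => (Nat.primeCounting ⌊x⌋₊ : ℝ) * Real.log x - Chebyshev.theta x)
      =o[atTop] (fun x : ℝ => x) := by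
    have h1 := Chebyshev.primeCounting_sub_theta_div_log_isBigO.mul
      (isBigO_refl (fun x : ℝ => Real.log x) atTop)
    have h2 : (fun x : ℝ => x / Real.log x ^ 2 * Real.log x) =o[atTop] (fun x : ℝ => x) := by
      have h3 : Tendsto (fun x : ℝ => (Real.log x)⁻¹) atTop (nhds 0) :=
        tendsto_inv_atTop_zero.comp Real.tendsto_log_atTop
      have h4 := (isBigO_refl (fun x : ℝ => x) atTop).mul_isLittleO ((isLittleO_one_iff ℝ).2 h3)
      refine h4.congr' ?_ (by simp)
      filter_upwards [eventually_gt_atTop 1] with x hx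
      have := Real.log_pos hx
      field_simp
    refine (h1.trans_isLittleO h2).congr' ?_ EventuallyEq.rfl
    filter_upwards [eventually_gt_atTop 1] with x hx
    have := Real.log_pos hx
    field_simp
  refine IsBigO.trans_isLittleO (IsBigO.of_bound 1 ?_)
    ((hpi.const_mul_left K).add (hlog.const_mul_left (∑ p ∈ S, g p)))
  filter_upwards [eventually_gt_atTop 1] with x hx
  have hl := Real.log_pos hx
  have hP : ∀ p ∈ primesUpTo x, Nat.Prime p ∧ 0 ≤ Real.log p ∧ Real.log p ≤ Real.log x := by
    intro p hp
    simp only [primesUpTo, Finset.mem_filter, Finset.mem_Iic] at hp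
    have h0 : (0:ℝ) < p := by exact_mod_cast hp.2.pos
    refine ⟨hp.2, Real.log_natCast_nonneg p, Real.log_le_log h0 ?_⟩
    exact (Nat.le_floor_iff (by linarith)).1 hp.1
  have e1 : (∑ p ∈ primesUpTo x, g p) * Real.log x - ∑ p ∈ primesUpTo x, Real.log p * g p
      = ∑ p ∈ primesUpTo x, g p * (Real.log x - Real.log p) := by
    rw [Finset.sum_mul, ← Finset.sum_sub_distrib]
    exact Finset.sum_congr rfl fun p _ => by ring
  have e2 : K * ((Nat.primeCounting ⌊x⌋₊ : ℝ) * Real.log x - Chebyshev.theta x)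
      = ∑ p ∈ primesUpTo x, K * (Real.log x - Real.log p) := by
    rw [← Finset.mul_sum, Finset.sum_sub_distrib, aux_theta, Finset.sum_const, nsmul_eq_mul, aux_pi]
  have e3 : ∑ p ∈ primesUpTo x, (if p ∈ S then g p * Real.log x else 0)
      ≤ (∑ p ∈ S, g p) * Real.log x := by
    rw [← Finset.sum_filter, Finset.sum_mul]
    refine Finset.sum_le_sum_of_subset_of_nonneg ?_ fun p _ _ => mul_nonneg (hg p) hl.le
    intro p hp
    exact (Finset.mem_filter.1 hp).2
  have hnn : 0 ≤ ∑ p ∈ primesUpTo x, g p * (Real.log x - Real.log p) :=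
    Finset.sum_nonneg fun p hp => mul_nonneg (hg p) (sub_nonneg.2 (hP p hp).2.2)
  have hle : ∑ p ∈ primesUpTo x, g p * (Real.log x - Real.log p)
      ≤ ∑ p ∈ primesUpTo x, K * (Real.log x - Real.log p)
        + ∑ p ∈ primesUpTo x, (if p ∈ S then g p * Real.log x else 0) := by
    rw [← Finset.sum_add_distrib]
    refine Finset.sum_le_sum fun p hp => ?_
    obtain ⟨h1, h2, h3⟩ := hP p hp
    have h4 : 0 ≤ Real.log x - Real.log p := sub_nonneg.2 h3
    split_ifs with h
    · have := mul_nonneg hK0 h4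
      have := mul_nonneg (hg p) h2
      nlinarith
    · simpa using mul_le_mul_of_nonneg_right (hK p h1 h) h4
  rw [e1, e2, one_mul, Real.norm_eq_abs, Real.norm_eq_abs, abs_of_nonneg hnn]
  exact (hle.trans (by linarith)).trans (le_abs_self _)

theorem sum_add_sq_eq_two_x_div_log_add_littleO (a b : ℕ → ℝ) (S : Finset ℕ)
    (hS : ∀ p ∈ S, Nat.Prime p) (M : ℝ) (hM : 0 < M)
    (ha : ∀ p : ℕ, Nat.Prime p → p ∉ S → |a p| ≤ M)
    (hb : ∀ p : ℕ, Nat.Prime p → p ∉ S → |b p| ≤ M)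
    (c C : ℝ) (hc : 0 < c) (hC : 0 < C)
    (hPNTa : ∀ᶠ x : ℝ in atTop,
      |(∑ p ∈ primesUpTo x, Real.log p * (a p) ^ 2) - x| ≤
        C * x * Real.exp (-c * Real.sqrt (Real.log x)))
    (hPNTb : ∀ᶠ x : ℝ in atTop,
      |(∑ p ∈ primesUpTo x, Real.log p * (b p) ^ 2) - x| ≤
        C * x * Real.exp (-c * Real.sqrt (Real.log x)))
    (hPNTab : ∀ᶠ x : ℝ in atTop,
      |∑ p ∈ primesUpTo x, Real.log p * (a p * b p)| ≤
        C * x * Real.exp (-c * Real.sqrt (Real.log x))) :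
    (fun x : ℝ => (∑ p ∈ primesUpTo x, (a p + b p) ^ 2) - 2 * (x / Real.log x))
      =o[atTop] (fun x : ℝ => x / Real.log x) := by
  have hT := aux_T a b c C hc hPNTa hPNTb hPNTab
  have hD := aux_D (fun p => (a p + b p) ^ 2) (fun p => sq_nonneg _) S ((2 * M) ^ 2)
    (fun p hp hpS => by
      have h1 := ha p hp hpS
      have h2 := hb p hp hpS
      refine sq_le_sq' ?_ ?_ <;> linarith [abs_le.1 h1, abs_le.1 h2, (abs_le.1 h1).1,
        (abs_le.1 h2).1, (abs_le.1 h1).2, (abs_le.1 h2).2]) (sq_nonneg _)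
  have h := (hD.add hT).mul_isBigO (isBigO_refl (fun x : ℝ => (Real.log x)⁻¹) atTop)
  refine h.congr' ?_ (by simp [div_eq_mul_inv])
  filter_upwards [eventually_gt_atTop 1] with x hx
  have := Real.log_pos hx
  field_simp
  ring
end

section
/- Let λF, λG : ℕ → ℝ, let S be a finite set of primes, let m > 0, let c ∈ (0,4), and let α ∈ ℝ. Assume: (i) |λF(p)| ≤ 4 for every prime p ∉ S; (ii) ∑_{p ≤ x, p prime, p ∉ S} λF(p)² = m·x/log x + o(x/log x) as x → ∞; (iii) #{p ≤ x : p prime and |λG(p)| > c} ≥ α·x/log x for all sufficiently large x. Then liminf_{x→∞} (log x / x) · ∑_{p ≤ x, p prime, |λG(p)| > c} λF(p)² ≥ 16α + m − 16. -/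
open Filter Asymptotics

open MeasureTheory FourierTransform Topology

lemma pnt_kernel : ∃ (φ : ℝ → ℂ) (K : ℝ → ℝ), Continuous φ ∧ HasCompactSupport φ ∧
    Continuous K ∧ Integrable K ∧ (∀ u, 0 ≤ K u) ∧ 0 < ∫ u, K u ∧ ∀ u, 𝓕 φ u = K u := by
  let b : ContDiffBump (0:ℝ) := ⟨1, 2, by norm_num, by norm_num⟩
  let B : ℝ → ℂ := fun x => ((b x : ℝ) : ℂ)
  have hBs : HasCompactSupport B := b.hasCompactSupport.comp_left (g := Complex.ofReal) (by simp)
  have hBc : ContDiff ℝ ((⊤ : ℕ∞) : WithTop ℕ∞) B := Complex.ofRealCLM.contDiff.comp b.contDiff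
  have hBcont : Continuous B := hBc.continuous
  have hBi : Integrable B := hBcont.integrable_of_hasCompactSupport hBs
  let S : SchwartzMap ℝ ℂ := hBs.toSchwartzMap hBc
  have hS : 𝓕 (S : ℝ → ℂ) = 𝓕 B := rfl
  have hreal : ∀ u, (starRingEnd ℂ) (𝓕 B u) = 𝓕 B u := by
    intro u
    rw [Real.fourier_eq', ← integral_conj, ← integral_neg_eq_self]
    congr 1
    ext v
    have : B (-v) = B v := by simp only [B, b.neg]
    simp only [smul_eq_mul, map_mul, this]
    rw [← Complex.exp_conj, show (starRingEnd ℂ) (B v) = B v from Complex.conj_ofReal _, mul_eq_mul_right_iff]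
    left
    congr 1
    have h2 : (starRingEnd ℂ) (2:ℂ) = 2 := map_ofNat _ 2
    simp [h2]
  have hnorm : ∀ u, 𝓕 B u * 𝓕 B u = ((‖𝓕 B u‖^2 : ℝ) : ℂ) := by
    intro u
    have := Complex.conj_mul' (𝓕 B u)
    rw [hreal] at this
    rw [this]
    norm_cast
  have hFc : Continuous (𝓕 B) := (𝓕 S).continuous
  refine ⟨convolution B B (ContinuousLinearMap.mul ℂ ℂ) volume, fun u => ‖𝓕 B u‖^2, ?_, ?_, ?_, ?_, ?_, ?_, ?_⟩
  · exact hBs.continuous_convolution_left _ hBcont hBi.locallyIntegrable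
  · exact hBs.convolution _ hBs
  · fun_prop
  · have := ((𝓕 S).memLp 2 volume)
    exact this.integrable_norm_pow (by norm_num)
  · intro u; positivity
  · have := SchwartzMap.integral_norm_sq_fourier S
    have h2 : ∫ u, ‖𝓕 B u‖^2 = ∫ u, ‖B u‖^2 := this
    rw [h2]
    apply Continuous.integral_pos_of_hasCompactSupport_nonneg_nonzero (x := 0)
    · fun_prop
    · exact hBs.comp_left (g := fun z => ‖z‖^2) (by simp)
    · intro u; positivity
    · simp only [B]
      rw [b.one_of_mem_closedBall (by simp [b])]; simp
  · intro u
    rw [Real.fourier_mul_convolution_eq hBi hBi]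
    exact hnorm u

lemma pnt_kernel' (η ε : ℝ) (hη : 0 < η) (hε : 0 < ε) : ∃ (φ : ℝ → ℂ) (K : ℝ → ℝ),
    Continuous φ ∧ HasCompactSupport φ ∧
    Continuous K ∧ Integrable K ∧ (∀ u, 0 ≤ K u) ∧ 0 < ∫ u, K u ∧ (∀ u, 𝓕 φ u = K u) ∧
    (1 - ε) * ∫ u, K u ≤ ∫ u in Set.Icc (-η) η, K u := by
  obtain ⟨φ, K, h1, h2, h3, h4, h5, h6, h7⟩ := pnt_kernel
  have hlim : Tendsto (fun R : ℝ => ∫ u in (-R)..R, K u) atTop (𝓝 (∫ u, K u)) :=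
    intervalIntegral_tendsto_integral h4 tendsto_neg_atTop_atBot tendsto_id
  have hev := (hlim.eventually (lt_mem_nhds (show (1 - ε) * ∫ u, K u < ∫ u, K u by nlinarith)))
  obtain ⟨R, hR, hR0⟩ := (hev.and (eventually_gt_atTop 0)).exists
  set l := R / η with hl
  have hlp : 0 < l := by positivity
  have hint : ∫ u, l * K (l * u) = ∫ u, K u := by
    rw [integral_const_mul, Measure.integral_comp_mul_left, abs_of_pos (by positivity), smul_eq_mul]
    field_simp
  refine ⟨fun t => φ (t / l), fun u => l * K (l * u), by fun_prop, ?_, by fun_prop,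
    (h4.comp_mul_left' hlp.ne').const_mul _, fun u => mul_nonneg hlp.le (h5 _), ?_, ?_, ?_⟩
  · simp_rw [div_eq_mul_inv]
    exact h2.comp_homeomorph (Homeomorph.mulRight₀ l⁻¹ (by positivity))
  · rw [hint]; exact h6
  · intro u
    push_cast
    rw [← h7, Real.fourier_eq', Real.fourier_eq']
    have := Measure.integral_comp_div (fun v : ℝ => Complex.exp (↑(-2 * Real.pi * inner ℝ v (l * u)) * Complex.I) • φ v) l
    rw [abs_of_pos hlp, Complex.real_smul] at this
    rw [← this]
    congr 1; ext v
    congr 4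
    simp
    field_simp
  · rw [hint, integral_Icc_eq_integral_Ioc, ← intervalIntegral.integral_of_le (by linarith),
      intervalIntegral.integral_const_mul, intervalIntegral.mul_integral_comp_mul_left]
    have : l * η = R := by rw [hl]; field_simp
    rw [mul_neg, this]; exact hR.le

noncomputable def pntH (u : ℝ) : ℝ := Chebyshev.psi (Real.exp u) * Real.exp (-u)

lemma pntH_nonneg (u : ℝ) : 0 ≤ pntH u :=
  mul_nonneg (Chebyshev.psi_nonneg _) (Real.exp_pos _).le

lemma pntH_le (u : ℝ) : pntH u ≤ Real.log 4 + 4 := by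
  unfold pntH
  have := Chebyshev.psi_le_const_mul_self (Real.exp_pos u).le
  calc _ ≤ ((Real.log 4 + 4) * Real.exp u) * Real.exp (-u) := by gcongr
    _ = _ := by rw [mul_assoc, ← Real.exp_add]; simp

lemma pntH_meas : Measurable pntH := by
  unfold pntH
  exact (Chebyshev.psi_mono.measurable.comp Real.measurable_exp).mul (by fun_prop)

lemma pntH_mono (u v : ℝ) (h : u ≤ v) : pntH u * Real.exp (-(v - u)) ≤ pntH v := by
  unfold pntH
  rw [mul_assoc, ← Real.exp_add]
  have : -u + -(v - u) = -v := by ring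
  rw [this]
  exact mul_le_mul_of_nonneg_right (Chebyshev.psi_mono (Real.exp_le_exp.mpr h)) (Real.exp_pos _).le

lemma pnt_L : ∃ g : ℂ → ℂ, ContinuousOn g {s | 1 ≤ s.re} ∧ ∀ s : ℂ, 1 < s.re →
    LSeries (fun n => (ArithmeticFunction.vonMangoldt n : ℂ)) s = g s + 1 / (s - 1) := by
  refine ⟨ArithmeticFunction.vonMangoldt.LFunctionResidueClassAux (1 : ZMod 1),
    ArithmeticFunction.vonMangoldt.continuousOn_LFunctionResidueClassAux _, fun s hs => ?_⟩
  rw [ArithmeticFunction.vonMangoldt.eqOn_LFunctionResidueClassAux isUnit_one hs]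
  have : ∀ n, ArithmeticFunction.vonMangoldt.residueClass (1 : ZMod 1) n = ArithmeticFunction.vonMangoldt n := by
    intro n
    simp only [ArithmeticFunction.vonMangoldt.residueClass]
    rw [Set.indicator_of_mem]
    exact Subsingleton.elim _ _
  simp [this]

lemma pnt_L2 (s : ℂ) (hs : 1 < s.re) :
    LSeries (fun n => (ArithmeticFunction.vonMangoldt n : ℂ)) s =
      s * ∫ u in Set.Ioi (0:ℝ), (pntH u : ℂ) * Complex.exp (-(s - 1) * u) := by
  rw [LSeries_eq_mul_integral_of_nonneg (fun n => ArithmeticFunction.vonMangoldt n) zero_le_one hs ?_ (fun n => ArithmeticFunction.vonMangoldt_nonneg)]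
  · congr 1
    have himg : Real.exp '' Set.Ioi 0 = Set.Ioi 1 := by
      ext x
      constructor
      · rintro ⟨u, hu, rfl⟩
        exact Real.one_lt_exp_iff.mpr hu
      · intro hx
        have hx : 1 < x := hx
        exact ⟨Real.log x, Real.log_pos hx, Real.exp_log (by linarith)⟩
    rw [← himg, integral_image_eq_integral_abs_deriv_smul measurableSet_Ioi
      (fun x _ => (Real.hasDerivAt_exp x).hasDerivWithinAt) Real.exp_injective.injOn]
    congr 1
    ext u
    have hpsi : (∑ k ∈ Finset.Icc 1 ⌊Real.exp u⌋₊, (ArithmeticFunction.vonMangoldt k : ℂ)) =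
        (Chebyshev.psi (Real.exp u) : ℂ) := by
      rw [Chebyshev.psi]; push_cast; rfl
    rw [hpsi, abs_of_pos (Real.exp_pos u), Complex.real_smul, pntH, Complex.ofReal_exp,
      ← Complex.ofReal_exp, Complex.cpow_def_of_ne_zero (by exact_mod_cast (Real.exp_pos u).ne'),
      ← Complex.ofReal_log (Real.exp_pos u).le, Real.log_exp]
    push_cast
    rw [mul_left_comm, ← Complex.exp_add, mul_assoc, ← Complex.exp_add]
    congr 2
    ring
  · refine IsBigO.of_bound (Real.log 4 + 4) ?_
    filter_upwards with n
    have := Chebyshev.psi_le_const_mul_self (x := n) (by positivity)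
    have h2 : Chebyshev.psi n = ∑ k ∈ Finset.Icc 1 n, ArithmeticFunction.vonMangoldt k := by
      rw [Chebyshev.psi, Nat.floor_natCast]; rfl
    rw [← h2, Real.norm_of_nonneg (Chebyshev.psi_nonneg _)]
    simpa using this

lemma pnt_bd (u : ℝ) : ‖(((pntH u - 1 : ℝ)) : ℂ)‖ ≤ Real.log 4 + 4 := by
  rw [Complex.norm_real, Real.norm_eq_abs, abs_le]
  have h1 := pntH_nonneg u
  have h2 := pntH_le u
  have := Real.log_nonneg (show (1:ℝ) ≤ 4 by norm_num)
  constructor <;> linarith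

lemma pnt_intexp (a : ℂ) (ha : 0 < a.re) :
    IntegrableOn (fun u : ℝ => Complex.exp (-a * u)) (Set.Ioi 0) :=
  integrableOn_exp_mul_complex_Ioi (by simpa using ha) 0

lemma pnt_laplace : ∃ g : ℂ → ℂ, ContinuousOn g {s | 1 ≤ s.re} ∧ ∀ s : ℂ, 1 < s.re →
    ∫ u in Set.Ioi (0:ℝ), ((pntH u - 1 : ℝ) : ℂ) * Complex.exp (-(s - 1) * u) = g s := by
  obtain ⟨g, hg, hg2⟩ := pnt_L
  have hne : ∀ s : ℂ, 1 ≤ s.re → s ≠ 0 := by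
    rintro s hs rfl; simp at hs; linarith
  refine ⟨fun s => (g s - 1) / s, ?_, fun s hs => ?_⟩
  · exact (hg.sub continuousOn_const).div continuousOn_id (fun s hs => hne s hs)
  · have h1 := pnt_L2 s hs
    rw [hg2 s hs] at h1
    have hre : 0 < (s - 1).re := by simpa using hs
    have hi := pnt_intexp (s - 1) hre
    have hs0 := hne s hs.le
    have hs1 : s - 1 ≠ 0 := by intro h; rw [h] at hre; simp at hre
    have hH : IntegrableOn (fun u : ℝ => (pntH u : ℂ) * Complex.exp (-(s - 1) * u)) (Set.Ioi 0) := by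
      refine Integrable.bdd_mul (c := Real.log 4 + 4) hi ?_ ?_
      · exact (Complex.measurable_ofReal.comp pntH_meas).aestronglyMeasurable
      · filter_upwards with u
        rw [Complex.norm_real, Real.norm_of_nonneg (pntH_nonneg u)]
        exact pntH_le u
    have h3 := integral_exp_mul_complex_Ioi (a := -(s-1)) (by simpa using hs) 0
    have h5 : ∀ u : ℝ, ((pntH u - 1 : ℝ) : ℂ) * Complex.exp (-(s - 1) * u) =
        (pntH u : ℂ) * Complex.exp (-(s - 1) * u) - Complex.exp (-(s - 1) * u) := by
      intro u; push_cast; ring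
    simp_rw [h5]
    rw [integral_sub hH hi, h3]
    have h4 : ∫ u in Set.Ioi (0:ℝ), (pntH u : ℂ) * Complex.exp (-(s - 1) * u) = (g s + 1/(s-1))/s := by
      rw [h1]; field_simp
    rw [h4, Complex.ofReal_zero, mul_zero, Complex.exp_zero, neg_div_neg_eq]
    field_simp
    ring

lemma pnt_fubini (g : ℂ → ℂ) (hg : ∀ s : ℂ, 1 < s.re →
    ∫ u in Set.Ioi (0:ℝ), ((pntH u - 1 : ℝ) : ℂ) * Complex.exp (-(s - 1) * u) = g s)
    (φ : ℝ → ℂ) (hφ : Integrable φ) (δ : ℝ) (hδ : 0 < δ) (y : ℝ) :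
    ∫ u in Set.Ioi (0:ℝ), (((pntH u - 1) * Real.exp (-δ * u) : ℝ) : ℂ) * 𝓕 φ (u - y) =
    ∫ t : ℝ, Complex.exp (2 * Real.pi * t * y * Complex.I) * φ t *
      g (1 + δ + 2 * Real.pi * t * Complex.I) := by
  have hA : Integrable (fun u : ℝ => (((pntH u - 1) * Real.exp (-δ * u) : ℝ) : ℂ))
      (volume.restrict (Set.Ioi 0)) := by
    have := pnt_intexp δ (by simpa using hδ)
    have h2 := Integrable.bdd_mul (c := Real.log 4 + 4) (f := fun u => ((pntH u - 1 : ℝ) : ℂ)) this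
      (Complex.measurable_ofReal.comp (pntH_meas.sub_const 1)).aestronglyMeasurable
      (by filter_upwards with u; exact pnt_bd u)
    refine h2.congr ?_
    filter_upwards with u
    push_cast; rfl
  have hP := (hA.mul_prod hφ)
  have hP2 : Integrable (fun z : ℝ × ℝ => Complex.exp (((-2 * Real.pi * (z.2 * (z.1 - y)) : ℝ) : ℂ) * Complex.I) *
      ((((pntH z.1 - 1) * Real.exp (-δ * z.1) : ℝ) : ℂ) * φ z.2))
      ((volume.restrict (Set.Ioi 0)).prod volume) := by
    refine hP.bdd_mul (c := 1) ?_ ?_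
    · exact Continuous.aestronglyMeasurable (by fun_prop)
    · filter_upwards with z
      rw [Complex.norm_exp_ofReal_mul_I]
  have hswap := integral_integral_swap (f := fun u t => Complex.exp (((-2 * Real.pi * (t * (u - y)) : ℝ) : ℂ) * Complex.I) *
      ((((pntH u - 1) * Real.exp (-δ * u) : ℝ) : ℂ) * φ t)) hP2
  calc _ = ∫ u in Set.Ioi (0:ℝ), ∫ t : ℝ, Complex.exp (((-2 * Real.pi * (t * (u - y)) : ℝ) : ℂ) * Complex.I) *
      ((((pntH u - 1) * Real.exp (-δ * u) : ℝ) : ℂ) * φ t) := by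
        congr 1; ext u
        rw [Real.fourier_eq', ← integral_const_mul]
        congr 1; ext t
        simp only [smul_eq_mul, RCLike.inner_apply, conj_trivial]
        rw [mul_comm t (u - y)]
        ring
    _ = _ := by
        rw [hswap]
        congr 1; ext t
        rw [← hg _ (by simpa using hδ), ← integral_const_mul]
        congr 1; ext u
        have : Complex.exp (((-2 * Real.pi * (t * (u - y)) : ℝ) : ℂ) * Complex.I) * ((Real.exp (-δ * u) : ℝ) : ℂ)
          = Complex.exp (2 * Real.pi * t * y * Complex.I) * Complex.exp (-(1 + δ + 2 * Real.pi * t * Complex.I - 1) * u) := by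
          rw [Complex.ofReal_exp, ← Complex.exp_add, ← Complex.exp_add]
          congr 1; push_cast; ring
        push_cast at this ⊢
        linear_combination ((pntH u : ℂ) - 1) * φ t * this

lemma pnt_limit (g : ℂ → ℂ) (hgc : ContinuousOn g {s | 1 ≤ s.re}) (hg : ∀ s : ℂ, 1 < s.re →
    ∫ u in Set.Ioi (0:ℝ), ((pntH u - 1 : ℝ) : ℂ) * Complex.exp (-(s - 1) * u) = g s)
    (φ : ℝ → ℂ) (hφ : Continuous φ) (hφs : HasCompactSupport φ) (hF : Integrable (𝓕 φ)) (y : ℝ) :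
    ∫ u in Set.Ioi (0:ℝ), ((pntH u - 1 : ℝ) : ℂ) * 𝓕 φ (u - y) =
    ∫ t : ℝ, Complex.exp (2 * Real.pi * t * y * Complex.I) * φ t *
      g (1 + 2 * Real.pi * t * Complex.I) := by
  have hφi : Integrable φ := hφ.integrable_of_hasCompactSupport hφs
  have hFy : Integrable (fun u => 𝓕 φ (u - y)) (volume.restrict (Set.Ioi 0)) :=
    (hF.comp_sub_right y).integrableOn
  have h1 : Tendsto (fun δ : ℝ => ∫ u in Set.Ioi (0:ℝ),
      (((pntH u - 1) * Real.exp (-δ * u) : ℝ) : ℂ) * 𝓕 φ (u - y)) (𝓝[>] 0)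
      (𝓝 (∫ u in Set.Ioi (0:ℝ), ((pntH u - 1 : ℝ) : ℂ) * 𝓕 φ (u - y))) := by
    refine tendsto_integral_filter_of_dominated_convergence
      (fun u => (Real.log 4 + 4) * ‖𝓕 φ (u - y)‖) ?_ ?_ (hFy.norm.const_mul _) ?_
    · filter_upwards with δ
      refine AEStronglyMeasurable.mul ?_ hFy.1
      refine (Complex.measurable_ofReal.comp ((pntH_meas.sub_const 1).mul ?_)).aestronglyMeasurable
      fun_prop
    · filter_upwards [self_mem_nhdsWithin] with δ hδ
      have hδ : 0 < δ := hδ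
      filter_upwards [ae_restrict_mem measurableSet_Ioi] with u hu
      have hu : 0 < u := hu
      rw [norm_mul, Complex.ofReal_mul, norm_mul]
      gcongr
      calc _ ≤ (Real.log 4 + 4) * 1 := by
            gcongr
            · exact pnt_bd u
            · rw [Complex.norm_real, Real.norm_of_nonneg (Real.exp_pos _).le, Real.exp_le_one_iff]
              nlinarith
        _ = _ := mul_one _
    · filter_upwards with u
      refine Tendsto.mul_const _ ?_
      have : Continuous (fun δ : ℝ => (((pntH u - 1) * Real.exp (-δ * u) : ℝ) : ℂ)) := by fun_prop
      have h := (this.tendsto 0).mono_left (nhdsWithin_le_nhds (s := Set.Ioi 0))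
      simpa using h
  have h2 : Tendsto (fun δ : ℝ => ∫ t : ℝ, Complex.exp (2 * Real.pi * t * y * Complex.I) * φ t *
      g (1 + δ + 2 * Real.pi * t * Complex.I)) (𝓝[>] 0)
      (𝓝 (∫ t : ℝ, Complex.exp (2 * Real.pi * t * y * Complex.I) * φ t *
      g (1 + 2 * Real.pi * t * Complex.I))) := by
    let Q : ℝ × ℝ → ℂ := fun z => g (1 + z.1 + 2 * Real.pi * z.2 * Complex.I)
    have hQ : ContinuousOn Q {z | 0 ≤ z.1} := by
      refine hgc.comp (by fun_prop) ?_
      intro z hz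
      simpa using hz
    have hQt : ∀ δ : ℝ, 0 ≤ δ → Continuous (fun t : ℝ => Q (δ, t)) := by
      intro δ hδ
      rw [← continuousOn_univ]
      exact hQ.comp (by fun_prop) (fun t _ => hδ)
    have hcomp : IsCompact (Set.Icc (0:ℝ) 1 ×ˢ tsupport φ) := isCompact_Icc.prod hφs
    obtain ⟨M, hM⟩ := hcomp.exists_bound_of_continuousOn (hQ.mono (fun z hz => hz.1.1))
    refine tendsto_integral_filter_of_dominated_convergence
      (fun t => M * ‖φ t‖) ?_ ?_ (hφi.norm.const_mul _) ?_
    · filter_upwards [self_mem_nhdsWithin] with δ hδ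
      have hδ : 0 < δ := hδ
      have := hQt δ hδ.le
      exact Continuous.aestronglyMeasurable (Continuous.mul (by fun_prop) this)
    · filter_upwards [Ioc_mem_nhdsGT (show (0:ℝ) < 1 by norm_num)] with δ hδ
      filter_upwards with t
      by_cases ht : t ∈ tsupport φ
      · have := hM (δ, t) ⟨⟨hδ.1.le, hδ.2⟩, ht⟩
        have he : ‖Complex.exp (2 * Real.pi * t * y * Complex.I)‖ = 1 := by
          have := Complex.norm_exp_ofReal_mul_I (2 * Real.pi * t * y)
          push_cast at this; exact this
        rw [norm_mul, norm_mul, he, one_mul, mul_comm]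
        gcongr
      · simp [image_eq_zero_of_notMem_tsupport ht]
    · filter_upwards with t
      refine Tendsto.const_mul _ ?_
      have hc : ContinuousOn (fun δ : ℝ => Q (δ, t)) (Set.Ici 0) :=
        hQ.comp (by fun_prop) (fun t ht => ht)
      have := ((hc 0 (by simp)).mono (Set.Ioi_subset_Ici_self)).tendsto
      simpa [Q] using this
  refine tendsto_nhds_unique h1 (h2.congr' ?_)
  filter_upwards [self_mem_nhdsWithin] with δ hδ
  exact (pnt_fubini g hg φ hφi δ hδ y).symm

lemma pnt_RL (φ : ℝ → ℂ) (K : ℝ → ℝ) (hφ : Continuous φ) (hφs : HasCompactSupport φ)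
    (hK : Integrable K) (hφK : ∀ u, 𝓕 φ u = K u) :
    Tendsto (fun y : ℝ => ∫ u in Set.Ioi (0:ℝ), (pntH u - 1) * K (u - y)) atTop (𝓝 0) := by
  obtain ⟨g, hgc, hg⟩ := pnt_laplace
  have hF : Integrable (𝓕 φ) := by
    have : 𝓕 φ = fun u => (K u : ℂ) := funext hφK
    rw [this]; exact hK.ofReal
  have hlim := Real.tendsto_integral_exp_smul_cocompact
    (fun t : ℝ => φ t * g (1 + 2 * Real.pi * t * Complex.I))
  have h2 := hlim.comp (tendsto_neg_atTop_atBot.mono_right (atBot_le_cocompact (α := ℝ)))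
  have h3 : Tendsto (fun y : ℝ => ((∫ u in Set.Ioi (0:ℝ), (pntH u - 1) * K (u - y) : ℝ) : ℂ)) atTop (𝓝 0) := by
    refine h2.congr (fun y => ?_)
    rw [← integral_complex_ofReal]
    have := pnt_limit g hgc hg φ hφ hφs hF y
    simp only [hφK] at this
    push_cast at this ⊢
    rw [this]
    simp only [Function.comp]
    congr 1; ext t
    rw [Circle.smul_def, Real.fourierChar_apply, smul_eq_mul, ← mul_assoc]
    congr 3
    push_cast; ring
  have h4 := (Complex.continuous_re.tendsto 0).comp h3
  simpa [Function.comp_def] using h4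

lemma pnt_upper (ε : ℝ) (hε : 0 < ε) : ∀ᶠ y : ℝ in atTop, pntH y ≤ 1 + ε := by
  obtain ⟨r, hr0, hr1, hr⟩ : ∃ r : ℝ, 0 < r ∧ r < 1 ∧ 1 + r ≤ (1 + ε) * (Real.exp (-(2 * r)) * (1 - r)) := by
    have hc : Continuous (fun r : ℝ => (1 + ε) * (Real.exp (-(2 * r)) * (1 - r)) - (1 + r)) := by fun_prop
    have h0 := (hc.tendsto 0).eventually (lt_mem_nhds (a := 0) (by simpa using hε))
    have h1 := h0.filter_mono (nhdsWithin_le_nhds (s := Set.Ioi 0))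
    obtain ⟨r, hr, hr2⟩ := (h1.and (Ioo_mem_nhdsGT (show (0:ℝ) < 1 by norm_num))).exists
    exact ⟨r, hr2.1, hr2.2, by linarith⟩
  obtain ⟨φ, K, h1, h2, h3, h4, h5, h6, h7, h8⟩ := pnt_kernel' r r hr0 hr0
  set I := ∫ u, K u with hI
  have hlim := pnt_RL φ K h1 h2 h4 h7
  have hev := hlim.eventually (gt_mem_nhds (show (0:ℝ) < r * I by positivity))
  have hev2 := (tendsto_atTop_add_const_right atTop r tendsto_id).eventually hev
  filter_upwards [hev2, eventually_gt_atTop 0] with Y hY hY0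
  simp only [id] at hY
  have hKi : Integrable (fun u => K (u - (Y + r))) := h4.comp_sub_right _
  have hHK : Integrable (fun u => pntH u * K (u - (Y + r))) := by
    refine hKi.bdd_mul (c := Real.log 4 + 4) pntH_meas.aestronglyMeasurable ?_
    filter_upwards with u
    rw [Real.norm_of_nonneg (pntH_nonneg u)]
    exact pntH_le u
  have e1 : ∫ u in Set.Ioi (0:ℝ), (pntH u - 1) * K (u - (Y + r)) =
      (∫ u in Set.Ioi (0:ℝ), pntH u * K (u - (Y + r))) - ∫ u in Set.Ioi (0:ℝ), K (u - (Y + r)) := by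
    rw [← integral_sub hHK.integrableOn hKi.integrableOn]
    congr 1; ext u; ring
  have e2 : ∫ u in Set.Ioi (0:ℝ), K (u - (Y + r)) ≤ I := by
    rw [hI, ← integral_sub_right_eq_self K (Y + r)]
    exact setIntegral_le_integral hKi (by filter_upwards with u; exact h5 _)
  have e3 : ∫ u in Set.Icc Y (Y + 2 * r), pntH u * K (u - (Y + r)) ≤
      ∫ u in Set.Ioi (0:ℝ), pntH u * K (u - (Y + r)) := by
    refine setIntegral_mono_set hHK.integrableOn ?_ ?_
    · filter_upwards with u; exact mul_nonneg (pntH_nonneg u) (h5 _)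
    · refine HasSubset.Subset.eventuallyLE ?_
      intro u hu
      exact lt_of_lt_of_le hY0 hu.1
  have e4 : ∫ u in Set.Icc Y (Y + 2 * r), (pntH Y * Real.exp (-(2 * r))) * K (u - (Y + r)) ≤
      ∫ u in Set.Icc Y (Y + 2 * r), pntH u * K (u - (Y + r)) := by
    refine setIntegral_mono_on (hKi.const_mul _).integrableOn hHK.integrableOn measurableSet_Icc ?_
    intro u hu
    refine mul_le_mul_of_nonneg_right ?_ (h5 _)
    refine le_trans ?_ (pntH_mono Y u hu.1)
    refine mul_le_mul_of_nonneg_left ?_ (pntH_nonneg Y)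
    rw [Real.exp_le_exp]
    linarith [hu.2]
  have e5 : ∫ u in Set.Icc Y (Y + 2 * r), K (u - (Y + r)) = ∫ u in Set.Icc (-r) r, K u := by
    rw [integral_Icc_eq_integral_Ioc, integral_Icc_eq_integral_Ioc,
      ← intervalIntegral.integral_of_le (by linarith), ← intervalIntegral.integral_of_le (by linarith),
      intervalIntegral.integral_comp_sub_right]
    congr 1 <;> ring
  rw [integral_const_mul, e5] at e4
  set E := Real.exp (-(2 * r))
  have hE : 0 < E := Real.exp_pos _
  have e6 : pntH Y * E * ((1 - r) * I) ≤ (1 + r) * I := by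
    have : pntH Y * E * ((1 - r) * I) ≤ pntH Y * E * ∫ u in Set.Icc (-r) r, K u :=
      mul_le_mul_of_nonneg_left h8 (mul_nonneg (pntH_nonneg Y) hE.le)
    linarith
  have e7 : pntH Y * (E * (1 - r)) ≤ 1 + r := by
    have : (pntH Y * (E * (1 - r))) * I ≤ (1 + r) * I := by linarith
    exact le_of_mul_le_mul_right this h6
  have e8 : pntH Y * (E * (1 - r)) ≤ (1 + ε) * (E * (1 - r)) := e7.trans hr
  exact le_of_mul_le_mul_right e8 (mul_pos hE (by linarith))

lemma pnt_pi (ε : ℝ) (hε : 0 < ε) :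
    ∀ᶠ x : ℝ in atTop, (Nat.primeCounting ⌊x⌋₊ : ℝ) ≤ (1 + ε) * (x / Real.log x) := by
  have h1 := Real.tendsto_log_atTop.eventually (pnt_upper (ε / 2) (by positivity))
  have h2 := Chebyshev.integral_theta_div_log_sq_isLittleO.bound (half_pos hε)
  filter_upwards [h1, h2, eventually_ge_atTop 2] with x hx1 hx2 hx
  have hlog : 0 < Real.log x := Real.log_pos (by linarith)
  rw [Chebyshev.primeCounting_eq_theta_div_log_add_integral hx]
  rw [pntH, Real.exp_neg, Real.exp_log (by linarith), ← div_eq_mul_inv, div_le_iff₀ (by linarith)] at hx1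
  have h3 := (Chebyshev.theta_le_psi x).trans hx1
  rw [Real.norm_of_nonneg (show 0 ≤ x / Real.log x by positivity)] at hx2
  have h4 := (le_abs_self _).trans hx2
  have h5 : Chebyshev.theta x / Real.log x ≤ (1 + ε / 2) * (x / Real.log x) := by
    rw [← mul_div_assoc]; gcongr
  linarith

/-- Under Weissauer's bound `|λF(p)| ≤ 4` off a finite set `S` of primes, the asymptotic
`∑_{p ≤ x, p ∉ S} λF(p)² = m·x/log x + o(x/log x)`, and the counting hypothesis
`#{p ≤ x : |λG(p)| > c} ≥ α·x/log x`, one has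
`liminf_{x→∞} (log x / x) · ∑_{p ≤ x, |λG(p)| > c} λF(p)² ≥ 16α + m − 16`. -/
theorem liminf_sum_sq_on_large_G (lamF lamG : ℕ → ℝ) (S : Finset ℕ)
    (hS : ∀ p ∈ S, Nat.Prime p) (m : ℝ) (hm : 0 < m)
    (c : ℝ) (hc : c ∈ Set.Ioo (0 : ℝ) 4) (α : ℝ)
    (hF : ∀ p : ℕ, Nat.Prime p → p ∉ S → |lamF p| ≤ 4)
    (hsum : (fun x : ℝ =>
        (∑ p ∈ (primesUpTo x).filter (fun p => p ∉ S), (lamF p) ^ 2) -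
          m * (x / Real.log x))
      =o[atTop] (fun x : ℝ => x / Real.log x))
    (hcount : ∀ᶠ x : ℝ in atTop,
      α * (x / Real.log x) ≤ ((primesUpTo x).filter (fun p => c < |lamG p|)).card) :
    16 * α + m - 16 ≤
      Filter.liminf
        (fun x : ℝ => (Real.log x / x) *
          ∑ p ∈ (primesUpTo x).filter (fun p => c < |lamG p|), (lamF p) ^ 2)
        atTop := by
  set X : ℝ → ℝ := fun x => x / Real.log x with hX
  have hcard : ∀ x : ℝ, ((primesUpTo x).card : ℝ) = Nat.primeCounting ⌊x⌋₊ := by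
    intro x
    norm_cast
    rw [primesUpTo, Nat.primeCounting, Nat.primeCounting', Nat.count_eq_card_filter_range]
    congr 1
    ext n
    simp [Nat.lt_succ_iff]
  have hXpos : ∀ᶠ x : ℝ in atTop, 0 < X x := by
    filter_upwards [eventually_gt_atTop 1] with x hx
    exact div_pos (by linarith) (Real.log_pos hx)
  have hinv : ∀ x : ℝ, Real.log x / x = (X x)⁻¹ := by intro x; simp [hX]
  have key : ∀ ε : ℝ, 0 < ε → ∀ᶠ x : ℝ in atTop, 16 * α + m - 16 - ε ≤ (Real.log x / x) *
          ∑ p ∈ (primesUpTo x).filter (fun p => c < |lamG p|), (lamF p) ^ 2 := by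
    intro ε hε
    filter_upwards [hXpos, hcount, pnt_pi (ε / 32) (by positivity), hsum.bound (half_pos hε)]
      with x hx h1 h2 h3
    rw [hinv, ← div_eq_inv_mul, le_div_iff₀ hx]
    rw [Real.norm_of_nonneg hx.le] at h3
    have h3 := (abs_le.mp h3).1
    rw [← hcard] at h2
    have hsplit := Finset.sum_filter_add_sum_filter_not ((primesUpTo x).filter (fun p => p ∉ S))
      (fun p => c < |lamG p|) (fun p => (lamF p)^2)
    have hcs := Finset.card_filter_add_card_filter_not (s := primesUpTo x) (fun p => c < |lamG p|)
    have hle1 : ∑ p ∈ ((primesUpTo x).filter (fun p => p ∉ S)).filter (fun p => c < |lamG p|), (lamF p)^2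
        ≤ ∑ p ∈ (primesUpTo x).filter (fun p => c < |lamG p|), (lamF p) ^ 2 := by
      refine Finset.sum_le_sum_of_subset_of_nonneg ?_ (fun _ _ _ => sq_nonneg _)
      exact Finset.filter_subset_filter _ (Finset.filter_subset _ _)
    have hle2 : ∑ p ∈ ((primesUpTo x).filter (fun p => p ∉ S)).filter (fun p => ¬ c < |lamG p|), (lamF p)^2
        ≤ 16 * (((primesUpTo x).filter (fun p => ¬ c < |lamG p|)).card : ℝ) := by
      have := Finset.sum_le_card_nsmul
        (((primesUpTo x).filter (fun p => p ∉ S)).filter (fun p => ¬ c < |lamG p|))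
        (fun p => (lamF p)^2) 16 ?_
      · refine this.trans ?_
        rw [nsmul_eq_mul, mul_comm]
        gcongr
        exact Finset.filter_subset _ _
      · intro p hp
        simp only [Finset.mem_filter, primesUpTo] at hp
        have := abs_le.mp (hF p hp.1.1.2 hp.1.2)
        nlinarith
    have hcs' : (((primesUpTo x).filter (fun p => c < |lamG p|)).card : ℝ) +
      (((primesUpTo x).filter (fun p => ¬ c < |lamG p|)).card : ℝ) = (primesUpTo x).card := by
      exact_mod_cast hcs
    simp only [hX] at *
    nlinarith
  have hcob : IsCoboundedUnder (· ≥ ·) atTop (fun x : ℝ => (Real.log x / x) *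
          ∑ p ∈ (primesUpTo x).filter (fun p => c < |lamG p|), (lamF p) ^ 2) := by
    refine IsBoundedUnder.isCoboundedUnder_ge ?_
    refine isBoundedUnder_of_eventually_le (a := m + 1 + ∑ p ∈ S, (lamF p)^2) ?_
    filter_upwards [hXpos, hsum.bound one_pos, Real.isLittleO_log_id_atTop.bound one_pos,
      eventually_gt_atTop 1]
      with x hx h3 h4 hx1
    rw [hinv, ← div_eq_inv_mul, div_le_iff₀ hx]
    rw [Real.norm_of_nonneg hx.le] at h3
    have h3 := (abs_le.mp h3).2
    have hl := Real.log_pos hx1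
    have hX1 : 1 ≤ X x := by
      rw [hX]; simp only
      rw [le_div_iff₀ hl, one_mul]
      linarith [Real.log_le_sub_one_of_pos (show 0 < x by linarith)]
    have hT : 0 ≤ ∑ p ∈ S, (lamF p)^2 := Finset.sum_nonneg (fun _ _ => sq_nonneg _)
    have hle : ∑ p ∈ (primesUpTo x).filter (fun p => c < |lamG p|), (lamF p) ^ 2 ≤
        ∑ p ∈ (primesUpTo x).filter (fun p => p ∉ S), (lamF p) ^ 2 + ∑ p ∈ S, (lamF p)^2 := by
      rw [← Finset.sum_union]
      · refine Finset.sum_le_sum_of_subset_of_nonneg ?_ (fun _ _ _ => sq_nonneg _)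
        intro p hp
        simp only [Finset.mem_union, Finset.mem_filter] at hp ⊢
        tauto
      · rw [Finset.disjoint_left]
        intro p hp
        simp only [Finset.mem_filter] at hp
        exact hp.2
    simp only [hX] at *
    nlinarith
  refine le_of_forall_pos_le_add (fun ε hε => ?_)
  have := le_liminf_of_le hcob (key ε hε)
  linarith
end

section
/- Let λF, λG : ℕ → ℝ, let S be a finite set of primes, let m > 0, let c ∈ (0,4), and let α ∈ ℝ with 16α + m − 16 > 0. Assume: (i) |λF(p)| ≤ 4 and |λG(p)| ≤ 4 for every prime p ∉ S; (ii) ∑_{p ≤ x, p prime, p ∉ S} λF(p)² = m·x/log x + o(x/log x) as x → ∞; (iii) ∑_{p ≤ x, p prime, p ∉ S} λF(p)·λG(p) = o(x/log x) as x → ∞; (iv) #{p ≤ x : p prime and |λG(p)| > c} ≥ α·x/log x for all sufficiently large x. Then liminf_{x→∞} (log x / x) · #{p ≤ x : p prime and λF(p)·λG(p) < 0} ≥ c²·(16α + m − 16)/512 > 0; in particular the set of primes p with λF(p)·λG(p) < 0 has positive lower density among the primes. -/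
open Filter Asymptotics

namespace SC
open MeasureTheory Topology
open scoped FourierTransform

noncomputable def aF (u : ℝ) : ℝ := Chebyshev.psi (Real.exp u) * Real.exp (-u)

noncomputable def hF (u : ℝ) : ℝ := aF u - (Set.Ioi (0:ℝ)).indicator (fun _ => (1:ℝ)) u

noncomputable def CC : ℝ := Real.log 4 + 4

lemma CC_pos : 0 < CC := by unfold CC; positivity

lemma aF_nonneg (u : ℝ) : 0 ≤ aF u :=
  mul_nonneg (Chebyshev.psi_nonneg _) (Real.exp_pos _).le

lemma aF_le (u : ℝ) : aF u ≤ CC := by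
  unfold aF CC
  have := Chebyshev.psi_le_const_mul_self (Real.exp_pos u).le
  rw [Real.exp_neg, ← div_eq_mul_inv, div_le_iff₀ (Real.exp_pos u)]
  exact this

lemma aF_zero {u : ℝ} (hu : u ≤ 0) : aF u = 0 := by
  unfold aF
  rw [Chebyshev.psi_eq_zero_of_le_one (by simpa using hu), zero_mul]

lemma hF_zero {u : ℝ} (hu : u ≤ 0) : hF u = 0 := by
  unfold hF
  rw [aF_zero hu]; simp [hu]

lemma measurable_aF : Measurable aF := by
  unfold aF
  exact (Chebyshev.psi_mono.measurable.comp Real.measurable_exp).mul (by fun_prop)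

lemma measurable_hF : Measurable hF := by
  unfold hF
  exact measurable_aF.sub (measurable_const.indicator measurableSet_Ioi)

lemma abs_hF_le (u : ℝ) : |hF u| ≤ CC + 1 := by
  unfold hF
  have h1 := aF_nonneg u
  have h2 := aF_le u
  have : 0 ≤ (Set.Ioi (0:ℝ)).indicator (fun _ => (1:ℝ)) u ∧ (Set.Ioi (0:ℝ)).indicator (fun _ => (1:ℝ)) u ≤ 1 := by
    by_cases h : u ∈ Set.Ioi (0:ℝ) <;> simp [h]
  rw [abs_le]; constructor <;> linarith [this.1, this.2, CC_pos]

noncomputable def G (s : ℂ) : ℂ :=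
  (ArithmeticFunction.vonMangoldt.LFunctionResidueClassAux (q := 1) 1 s - 1) / s

lemma continuousOn_G : ContinuousOn G {s | 1 ≤ s.re} := by
  unfold G
  refine ((ArithmeticFunction.vonMangoldt.continuousOn_LFunctionResidueClassAux (q := 1) 1).sub
    continuousOn_const).div continuousOn_id ?_
  intro s hs h
  change s = 0 at h
  subst h
  norm_num at hs

lemma integral_aF {s : ℂ} (hs : 1 < s.re) :
    LSeries (fun n => (ArithmeticFunction.vonMangoldt n : ℂ)) s =
      s * ∫ u in Set.Ioi (0:ℝ), (aF u : ℂ) * Complex.exp (-(s - 1) * u) := by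
  rw [LSeries_eq_mul_integral_of_nonneg (fun n => ArithmeticFunction.vonMangoldt n) (r := 1)
    zero_le_one hs ?_ (fun n => ArithmeticFunction.vonMangoldt_nonneg)]
  · congr 1
    have him : Set.Ioi (1:ℝ) = Real.exp '' (Set.Ioi 0) := by
      ext x; constructor
      · intro hx
        exact ⟨Real.log x, Real.log_pos hx, Real.exp_log (lt_trans one_pos hx)⟩
      · rintro ⟨y, hy, rfl⟩
        simpa using hy
    rw [him, integral_image_eq_integral_abs_deriv_smul measurableSet_Ioi
      (fun x _ => (Real.hasDerivAt_exp x).hasDerivWithinAt) Real.exp_injective.injOn]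
    refine integral_congr_ae (Eventually.of_forall fun u => ?_)
    simp only [aF, Chebyshev.psi_eq_sum_Icc, Complex.real_smul]
    have h0 : (((Real.exp u : ℝ)) : ℂ) ^ (-(s + 1)) = Complex.exp (-(s+1) * u) := by
      rw [Complex.cpow_def_of_ne_zero (by simp), ← Complex.ofReal_log (Real.exp_pos u).le,
        Real.log_exp, mul_comm]
    rw [h0]
    have h1 : ∑ k ∈ Finset.Icc 1 ⌊Real.exp u⌋₊, ((ArithmeticFunction.vonMangoldt k : ℝ) : ℂ)
       = ((∑ k ∈ Finset.Icc 0 ⌊Real.exp u⌋₊, ArithmeticFunction.vonMangoldt k : ℝ) : ℂ) := by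
      rw [← Chebyshev.psi_eq_sum_Icc, Chebyshev.psi]; push_cast; rfl
    rw [h1, abs_of_pos (Real.exp_pos u)]
    push_cast
    have : Complex.exp (-(s-1) * u) = Complex.exp u * Complex.exp u * Complex.exp (-(s+1) * u) := by
      rw [← Complex.exp_add, ← Complex.exp_add]; congr 1; ring
    rw [this]
    have : Complex.exp (-(u:ℂ)) * Complex.exp u = 1 := by
      rw [← Complex.exp_add]; simp
    linear_combination (-(∑ k ∈ Finset.Icc 0 ⌊Real.exp u⌋₊, ((ArithmeticFunction.vonMangoldt k : ℝ) : ℂ)) * Complex.exp u * Complex.exp (-(s+1) * u)) * this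
  · refine IsBigO.of_bound CC (Eventually.of_forall fun n => ?_)
    have h := Chebyshev.psi_le_const_mul_self (x := (n:ℝ)) (Nat.cast_nonneg n)
    have h2 : ∑ k ∈ Finset.Icc 1 n, ArithmeticFunction.vonMangoldt k = Chebyshev.psi n := by
      rw [Chebyshev.psi, Nat.floor_natCast]; rfl
    rw [h2, Real.norm_of_nonneg (Chebyshev.psi_nonneg _), Real.rpow_one, Real.norm_of_nonneg (Nat.cast_nonneg n)]
    exact h

lemma integrableOn_exp_mul {δ : ℝ} (hδ : 0 < δ) {f : ℝ → ℝ} (hf : Measurable f) {C : ℝ}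
    (hb : ∀ u, |f u| ≤ C) :
    IntegrableOn (fun u => f u * Real.exp (-δ * u)) (Set.Ioi 0) := by
  have h1 : IntegrableOn (fun u : ℝ => Real.exp (-δ * u)) (Set.Ioi 0) :=
    integrableOn_exp_mul_Ioi (by linarith) 0
  exact h1.bdd_mul (c := C) hf.aestronglyMeasurable (Eventually.of_forall fun u => hb u)

lemma integrableOn_cexp_mul {s : ℂ} (hs : 1 < s.re) {f : ℝ → ℝ} (hf : Measurable f) {C : ℝ}
    (hb : ∀ u, |f u| ≤ C) :
    IntegrableOn (fun u : ℝ => (f u : ℂ) * Complex.exp (-(s - 1) * u)) (Set.Ioi 0) := by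
  have h1 := integrableOn_exp_mul (δ := s.re - 1) (by linarith) hf hb
  refine Integrable.mono h1 ?_ (Eventually.of_forall fun u => ?_)
  · refine Measurable.aestronglyMeasurable ?_
    exact (Complex.measurable_ofReal.comp hf).mul (by fun_prop)
  · simp [Complex.norm_exp]

lemma laplace_hF {s : ℂ} (hs : 1 < s.re) :
    ∫ u in Set.Ioi (0:ℝ), (hF u : ℂ) * Complex.exp (-(s - 1) * u) = G s := by
  have hs0 : s ≠ 0 := by rintro rfl; norm_num at hs
  have hs1 : s - 1 ≠ 0 := by
    intro h; rw [sub_eq_zero] at h; subst h; norm_num at hs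
  have hA := integral_aF hs
  have hE := ArithmeticFunction.vonMangoldt.eqOn_LFunctionResidueClassAux (q := 1) (a := 1)
    isUnit_one hs
  have hR : (fun n => ((ArithmeticFunction.vonMangoldt.residueClass (q := 1) 1 n : ℝ) : ℂ)) =
      fun n => (ArithmeticFunction.vonMangoldt n : ℂ) := by
    ext n
    have : n ∈ {n : ℕ | (n : ZMod 1) = 1} := Subsingleton.elim _ _
    simp [ArithmeticFunction.vonMangoldt.residueClass, Set.indicator_of_mem this]
  simp only [hR] at hE
  have h1 : ∫ u in Set.Ioi (0:ℝ), (hF u : ℂ) * Complex.exp (-(s - 1) * u) =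
     ∫ u in Set.Ioi (0:ℝ), ((aF u : ℂ) * Complex.exp (-(s - 1) * u) - Complex.exp (-(s - 1) * u)) := by
    refine setIntegral_congr_fun measurableSet_Ioi fun u hu => ?_
    simp only [hF, Set.indicator_of_mem hu]
    push_cast; ring
  have hi1 := integrableOn_cexp_mul hs measurable_aF (C := CC) (fun u => by
    rw [abs_of_nonneg (aF_nonneg u)]; exact aF_le u)
  have hre : (-(s-1)).re < 0 := by simp; linarith
  have hi2 : IntegrableOn (fun u : ℝ => Complex.exp (-(s - 1) * u)) (Set.Ioi 0) :=
    integrableOn_exp_mul_complex_Ioi hre 0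
  rw [h1, integral_sub hi1 hi2, integral_exp_mul_complex_Ioi hre]
  have hA' : ∫ u in Set.Ioi (0:ℝ), (aF u : ℂ) * Complex.exp (-(s - 1) * u) =
     LSeries (fun n => (ArithmeticFunction.vonMangoldt n : ℂ)) s / s := by
    rw [hA]; field_simp
  rw [hA', G, hE]
  simp
  have hs2 : 1 - s ≠ 0 := sub_ne_zero.2 (sub_ne_zero.1 hs1).symm
  field_simp
  ring

lemma fourier_hF {δ : ℝ} (hδ : 0 < δ) (w : ℝ) :
    𝓕 (fun u : ℝ => ((hF u * Real.exp (-δ * u) : ℝ) : ℂ)) w =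
      G (1 + δ + 2 * Real.pi * w * Complex.I) := by
  rw [← laplace_hF (by simp [hδ]), Real.fourier_real_eq_integral_exp_smul,
    ← setIntegral_eq_integral_of_forall_compl_eq_zero (s := Set.Ioi 0)]
  · refine integral_congr_ae (Eventually.of_forall fun u => ?_)
    simp only [smul_eq_mul]
    push_cast
    rw [mul_left_comm, ← Complex.exp_add]
    congr 2; ring
  · intro x hx
    rw [hF_zero (by simpa using hx)]; simp

lemma integrable_hF_exp {δ : ℝ} (hδ : 0 < δ) : Integrable (fun u : ℝ => hF u * Real.exp (-δ * u)) := by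
  have := integrableOn_exp_mul hδ measurable_hF abs_hF_le
  refine (integrableOn_iff_integrable_of_support_subset ?_).1 this
  intro u hu
  by_contra h
  apply hu
  simp [hF_zero (not_lt.1 h)]

noncomputable def fej (v : ℝ) : ℝ := (1 - Real.cos (2 * Real.pi * v)) / (2 * Real.pi ^ 2 * v ^ 2)

noncomputable def tri (T t : ℝ) : ℝ := max 0 (1 - |t| / T)

lemma fej_nonneg (v : ℝ) : 0 ≤ fej v :=
  div_nonneg (by linarith [Real.cos_le_one (2 * Real.pi * v)]) (by positivity)

lemma measurable_fej : Measurable fej := by unfold fej; fun_prop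

lemma fej_le (v : ℝ) : fej v ≤ 2 * (1 + v ^ 2)⁻¹ := by
  rcases eq_or_ne v 0 with rfl | hv
  · simp [fej]
  have hv2 : 0 < v ^ 2 := by positivity
  have hpi := Real.pi_gt_three
  unfold fej
  rw [← div_eq_mul_inv, div_le_div_iff₀ (by positivity) (by positivity)]
  have h1 := Real.one_sub_sq_div_two_le_cos (x := 2 * Real.pi * v)
  have h2 := Real.neg_one_le_cos (2 * Real.pi * v)
  have h3 : 1 ≤ Real.pi ^ 2 := by nlinarith
  have h4 : (1 - Real.cos (2 * Real.pi * v)) * v ^ 2 ≤ 2 * v ^ 2 := by nlinarith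
  nlinarith

lemma integrable_fej : Integrable fej := by
  refine Integrable.mono (integrable_inv_one_add_sq.const_mul 2)
    measurable_fej.aestronglyMeasurable (Eventually.of_forall fun v => ?_)
  rw [Real.norm_of_nonneg (fej_nonneg v), Real.norm_of_nonneg (by positivity)]
  exact fej_le v

lemma integral_fej_pos : 0 < ∫ v, fej v := by
  rw [integral_pos_iff_support_of_nonneg fej_nonneg integrable_fej]
  refine lt_of_lt_of_le ?_ (measure_mono (s := Set.Ioo 0 1) ?_)
  · simp
  · intro v hv
    have h : Real.cos (2 * Real.pi * v) < 1 := by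
      refine lt_of_le_of_ne (Real.cos_le_one _) fun h => ?_
      rw [Real.cos_eq_one_iff] at h
      obtain ⟨n, hn⟩ := h
      have : (n : ℝ) = v := by
        have := Real.pi_pos
        field_simp at hn
        linarith
      have h1 := hv.1
      have h2 := hv.2
      rw [← this] at h1 h2
      norm_cast at h1 h2
      omega
    have h0 := hv.1
    have := Real.pi_pos
    exact (div_pos (by linarith) (by positivity)).ne'

lemma continuous_tri (T : ℝ) : Continuous (tri T) := by unfold tri; fun_prop

lemma tri_nonneg (T t : ℝ) : 0 ≤ tri T t := le_max_left _ _

lemma tri_zero {T t : ℝ} (hT : 0 < T) (h : T ≤ |t|) : tri T t = 0 := by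
  unfold tri
  apply max_eq_left
  have : 1 ≤ |t| / T := by rwa [le_div_iff₀ hT, one_mul]
  linarith

lemma tri_compact {T : ℝ} (hT : 0 < T) : HasCompactSupport (tri T) := by
  refine HasCompactSupport.intro (isCompact_Icc (a := -T) (b := T)) fun x hx => tri_zero hT ?_
  by_contra h
  rw [not_le, abs_lt] at h
  exact hx ⟨h.1.le, h.2.le⟩

lemma integrable_tri {T : ℝ} (hT : 0 < T) : Integrable (tri T) :=
  (continuous_tri T).integrable_of_hasCompactSupport (tri_compact hT)

lemma tri_integral_half {T w : ℝ} (hT : 0 < T) (hw : w ≠ 0) :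
    ∫ t in (0:ℝ)..T, (1 - t / T) * Real.cos (w * t) = (1 - Real.cos (w * T)) / (w ^ 2 * T) := by
  have hd : ∀ t ∈ Set.uIcc (0:ℝ) T, HasDerivAt
      (fun t => (1 - t / T) * (Real.sin (w * t) / w) - Real.cos (w * t) / (w ^ 2 * T))
      ((1 - t / T) * Real.cos (w * t)) t := by
    intro t _
    have e1 : HasDerivAt (fun t => w * t) w t := by simpa using (hasDerivAt_id t).const_mul w
    have e2 : HasDerivAt (fun t : ℝ => 1 - t / T) (-(1 / T)) t := by
      simpa using ((hasDerivAt_id t).div_const T).const_sub 1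
    have := (e2.mul (e1.sin.div_const w)).sub (e1.cos.div_const (w ^ 2 * T))
    refine this.congr_deriv ?_
    field_simp
    ring
  rw [intervalIntegral.integral_eq_sub_of_hasDerivAt hd (by
    apply Continuous.intervalIntegrable; fun_prop)]
  have : T / T = 1 := div_self hT.ne'
  simp [this]
  ring

lemma tri_integral {T w : ℝ} (hT : 0 < T) (hw : w ≠ 0) :
    ∫ t, tri T t * Real.cos (w * t) = 2 * ((1 - Real.cos (w * T)) / (w ^ 2 * T)) := by
  have h : (fun t => tri T t * Real.cos (w * t)) = fun t => (fun x => tri T x * Real.cos (w * x)) |t| := by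
    ext t
    rcases abs_choice t with h | h <;> simp [h, tri]
  rw [h, integral_comp_abs (f := fun x => tri T x * Real.cos (w * x)), ← tri_integral_half hT hw]
  congr 1
  rw [intervalIntegral.integral_of_le hT.le, setIntegral_eq_of_subset_of_forall_sdiff_eq_zero
    (f := fun x => tri T x * Real.cos (w * x))
    measurableSet_Ioi (s := Set.Ioc 0 T) (t := Set.Ioi 0) (fun x hx => hx.1)]
  · refine setIntegral_congr_fun measurableSet_Ioc fun t ht => ?_
    have : 0 ≤ 1 - t / T := by
      have : t / T ≤ 1 := by rw [div_le_one hT]; exact ht.2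
      linarith
    simp [tri, abs_of_pos ht.1, this]
  · intro x hx
    have h1 : 0 < x := hx.1
    have h2 : T < x := by
      by_contra h; exact hx.2 ⟨h1, not_lt.1 h⟩
    rw [tri_zero hT (by rw [abs_of_pos h1]; exact h2.le), zero_mul]

lemma tri_fourier {T v : ℝ} (hT : 0 < T) (hv : v ≠ 0) :
    𝓕 (fun t : ℝ => (tri T t : ℂ)) v = ((T * fej (T * v) : ℝ) : ℂ) := by
  have hpi := Real.pi_pos
  have hw : 2 * Real.pi * v ≠ 0 := by positivity
  rw [Real.fourier_real_eq_integral_exp_smul]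
  have hre : ∀ t : ℝ, (Complex.exp (↑(-2 * Real.pi * t * v) * Complex.I) • (tri T t : ℂ)) =
     ((tri T t * Real.cos (2 * Real.pi * v * t) : ℝ) : ℂ) -
       ((tri T t * Real.sin (2 * Real.pi * v * t) : ℝ) : ℂ) * Complex.I := by
    intro t
    rw [Complex.exp_mul_I]
    have : -2 * Real.pi * t * v = -(2 * Real.pi * v * t) := by ring
    rw [this, ← Complex.ofReal_cos, ← Complex.ofReal_sin, Real.cos_neg, Real.sin_neg]
    push_cast
    simp only [smul_eq_mul]
    ring
  simp_rw [hre]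
  have i1 : Integrable (fun t => tri T t * Real.cos (2 * Real.pi * v * t)) :=
    Continuous.integrable_of_hasCompactSupport ((continuous_tri T).mul (by fun_prop))
      (tri_compact hT).mul_right
  have i2 : Integrable (fun t => tri T t * Real.sin (2 * Real.pi * v * t)) :=
    Continuous.integrable_of_hasCompactSupport ((continuous_tri T).mul (by fun_prop))
      (tri_compact hT).mul_right
  have z2 : ∫ t, tri T t * Real.sin (2 * Real.pi * v * t) = 0 := by
    have := integral_neg_eq_self (fun t => tri T t * Real.sin (2 * Real.pi * v * t)) volume
    have h2 : ∀ t, tri T (-t) * Real.sin (2 * Real.pi * v * (-t)) = - (tri T t * Real.sin (2 * Real.pi * v * t)) := by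
      intro t; simp [tri]
    simp only [h2, integral_neg] at this
    linarith
  rw [integral_sub i1.ofReal (i2.ofReal.mul_const _), integral_mul_const, integral_complex_ofReal, integral_complex_ofReal, z2,
    tri_integral hT hw]
  simp only [Complex.ofReal_zero, zero_mul, sub_zero]
  congr 1
  unfold fej
  rw [show 2 * Real.pi * v * T = 2 * Real.pi * (T * v) by ring]
  field_simp

lemma integrable_fejT {T : ℝ} (hT : 0 < T) (y : ℝ) :
    Integrable (fun u => T * fej (T * (u - y))) := by
  have h1 : Integrable (fun u => fej (T * u)) := integrable_fej.comp_mul_left' hT.ne'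
  exact (h1.comp_sub_right y).const_mul T

lemma integrable_triC {T : ℝ} (hT : 0 < T) (y : ℝ) :
    Integrable (fun t : ℝ => Complex.exp (2 * Real.pi * t * y * Complex.I) * (tri T t : ℂ)) := by
  have h := (integrable_tri hT).ofReal (𝕜 := ℂ)
  refine h.bdd_mul (c := 1) (Continuous.aestronglyMeasurable (by fun_prop))
    (Eventually.of_forall fun t => ?_)
  rw [show (2 * Real.pi * t * y * Complex.I : ℂ) = ((2 * Real.pi * t * y : ℝ) : ℂ) * Complex.I by push_cast; ring,
    Complex.norm_exp_ofReal_mul_I]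

lemma triC_fourier {T u y : ℝ} (hT : 0 < T) (hu : u ≠ y) :
    𝓕 (fun t : ℝ => Complex.exp (2 * Real.pi * t * y * Complex.I) * (tri T t : ℂ)) u =
      ((T * fej (T * (u - y)) : ℝ) : ℂ) := by
  rw [← tri_fourier hT (sub_ne_zero.2 hu), Real.fourier_real_eq_integral_exp_smul,
    Real.fourier_real_eq_integral_exp_smul]
  refine integral_congr_ae (Eventually.of_forall fun t => ?_)
  simp only [smul_eq_mul]
  rw [← mul_assoc, ← Complex.exp_add]
  congr 2
  push_cast; ring

lemma key1 {δ T : ℝ} (hδ : 0 < δ) (hT : 0 < T) (y : ℝ) :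
    ((∫ u, hF u * Real.exp (-δ * u) * (T * fej (T * (u - y))) : ℝ) : ℂ) =
      ∫ t : ℝ, G (1 + δ + 2 * Real.pi * t * Complex.I) *
        (Complex.exp (2 * Real.pi * t * y * Complex.I) * (tri T t : ℂ)) := by
  have h := VectorFourier.integral_fourierIntegral_smul_eq_flip (L := innerₗ ℝ)
      Real.continuous_fourierChar continuous_inner ((integrable_hF_exp hδ).ofReal (𝕜 := ℂ)) (integrable_triC hT y)
  rw [flip_innerₗ] at h
  have h2 : ∫ t : ℝ, 𝓕 (fun u : ℝ => ((hF u * Real.exp (-δ * u) : ℝ) : ℂ)) t •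
      (Complex.exp (2 * Real.pi * t * y * Complex.I) * (tri T t : ℂ)) =
      ∫ u : ℝ, ((hF u * Real.exp (-δ * u) : ℝ) : ℂ) •
        𝓕 (fun t : ℝ => Complex.exp (2 * Real.pi * t * y * Complex.I) * (tri T t : ℂ)) u := h
  simp only [fourier_hF hδ, smul_eq_mul] at h2
  rw [h2, ← integral_complex_ofReal]
  refine integral_congr_ae ?_
  filter_upwards [(Set.finite_singleton y).countable.ae_notMem volume] with u hu
  rw [triC_fourier hT (by simpa using hu)]
  push_cast; ring

lemma key2 {T : ℝ} (hT : 0 < T) (y : ℝ) :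
    ((∫ u, hF u * (T * fej (T * (u - y))) : ℝ) : ℂ) =
      ∫ t : ℝ, G (1 + 2 * Real.pi * t * Complex.I) *
        (Complex.exp (2 * Real.pi * t * y * Complex.I) * (tri T t : ℂ)) := by
  have hL : Tendsto (fun δ : ℝ => ((∫ u, hF u * Real.exp (-δ * u) * (T * fej (T * (u - y))) : ℝ) : ℂ))
      (𝓝[>] 0) (𝓝 ((∫ u, hF u * (T * fej (T * (u - y))) : ℝ) : ℂ)) := by
    refine (Complex.continuous_ofReal.tendsto _).comp ?_
    refine tendsto_integral_filter_of_dominated_convergence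
      (fun u => (CC + 1) * (T * fej (T * (u - y)))) ?_ ?_ ((integrable_fejT hT y).const_mul _) ?_
    · refine Eventually.of_forall fun δ => Measurable.aestronglyMeasurable ?_
      have := measurable_fej
      have := measurable_hF
      fun_prop
    · filter_upwards [self_mem_nhdsWithin] with δ hδ
      refine Eventually.of_forall fun u => ?_
      have hf := fej_nonneg (T * (u - y))
      rw [norm_mul, Real.norm_of_nonneg (show 0 ≤ T * fej (T * (u - y)) by positivity)]
      refine mul_le_mul_of_nonneg_right ?_ (by positivity)
      rcases le_or_gt u 0 with hu | hu
      · rw [hF_zero hu]; simp; linarith [CC_pos]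
      · rw [norm_mul, Real.norm_eq_abs, Real.norm_of_nonneg (Real.exp_pos _).le]
        have h1 : Real.exp (-δ * u) ≤ 1 := by
          rw [Real.exp_le_one_iff]
          have : 0 < δ * u := mul_pos hδ hu
          linarith
        calc |hF u| * Real.exp (-δ * u) ≤ |hF u| * 1 :=
              mul_le_mul_of_nonneg_left h1 (abs_nonneg _)
          _ ≤ _ := by rw [mul_one]; exact abs_hF_le u
    · refine Eventually.of_forall fun u => ?_
      have hc : Continuous (fun δ : ℝ => hF u * Real.exp (-δ * u) * (T * fej (T * (u - y)))) := by fun_prop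
      have := (hc.tendsto 0).mono_left (nhdsWithin_le_nhds (s := Set.Ioi 0))
      simpa using this
  have hR : Tendsto (fun δ : ℝ => ∫ t : ℝ, G (1 + δ + 2 * Real.pi * t * Complex.I) *
        (Complex.exp (2 * Real.pi * t * y * Complex.I) * (tri T t : ℂ)))
      (𝓝[>] 0) (𝓝 (∫ t : ℝ, G (1 + 2 * Real.pi * t * Complex.I) *
        (Complex.exp (2 * Real.pi * t * y * Complex.I) * (tri T t : ℂ)))) := by
    have hK : IsCompact ((fun p : ℝ × ℝ => (1 + p.1 + 2 * Real.pi * p.2 * Complex.I : ℂ)) ''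
        (Set.Icc 0 1 ×ˢ Set.Icc (-T) T)) :=
      (isCompact_Icc.prod isCompact_Icc).image (by fun_prop)
    obtain ⟨M, hM⟩ := hK.exists_bound_of_continuousOn (continuousOn_G.mono (by
      rintro _ ⟨p, hp, rfl⟩
      have := hp.1.1
      simp [this]))
    refine tendsto_integral_filter_of_dominated_convergence
      (fun t => M * tri T t) ?_ ?_ ((integrable_tri hT).const_mul _) ?_
    · filter_upwards [self_mem_nhdsWithin] with δ hδ
      refine Continuous.aestronglyMeasurable ?_
      have h1 : Continuous (fun t : ℝ => G (1 + δ + 2 * Real.pi * t * Complex.I)) :=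
        continuousOn_G.comp_continuous (by fun_prop) (fun t => by
          have : (0:ℝ) < δ := hδ
          simp [this.le])
      have := continuous_tri T
      fun_prop
    · filter_upwards [Ioc_mem_nhdsGT (zero_lt_one' ℝ)] with δ hδ
      refine Eventually.of_forall fun t => ?_
      rw [norm_mul, norm_mul, Complex.norm_real, Real.norm_of_nonneg (tri_nonneg T t),
        show (2 * Real.pi * t * y * Complex.I : ℂ) = ((2 * Real.pi * t * y : ℝ) : ℂ) * Complex.I by push_cast; ring,
        Complex.norm_exp_ofReal_mul_I, one_mul]
      by_cases ht : t ∈ Set.Icc (-T) T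
      · exact mul_le_mul_of_nonneg_right (hM _ ⟨(δ, t), ⟨⟨hδ.1.le, hδ.2⟩, ht⟩, rfl⟩) (tri_nonneg T t)
      · rw [tri_zero hT]; simp
        by_contra h
        rw [not_le, abs_lt] at h
        exact ht ⟨h.1.le, h.2.le⟩
    · refine Eventually.of_forall fun t => ?_
      refine Tendsto.mul_const _ ?_
      have hc : ContinuousWithinAt G {s | 1 ≤ s.re} (1 + 2 * Real.pi * t * Complex.I) :=
        continuousOn_G _ (by simp)
      refine Tendsto.comp hc ?_
      refine tendsto_nhdsWithin_iff.2 ⟨?_, ?_⟩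
      · have : Continuous (fun δ : ℝ => (1 + δ + 2 * Real.pi * t * Complex.I : ℂ)) := by fun_prop
        have := (this.tendsto 0).mono_left (nhdsWithin_le_nhds (s := Set.Ioi 0))
        simpa using this
      · filter_upwards [self_mem_nhdsWithin] with δ hδ
        have : (0:ℝ) < δ := hδ
        simp [this.le]
  refine tendsto_nhds_unique hL (hR.congr' ?_)
  filter_upwards [self_mem_nhdsWithin] with δ hδ
  exact (key1 hδ hT y).symm

lemma key3 {T : ℝ} (hT : 0 < T) :
    Tendsto (fun y => ∫ u, hF u * (T * fej (T * (u - y)))) atTop (𝓝 0) := by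
  have h := Real.zero_at_infty_fourier (fun t : ℝ => G (1 + 2 * Real.pi * t * Complex.I) * (tri T t : ℂ))
  have h2 : Tendsto (fun y : ℝ => -y) atTop (cocompact ℝ) :=
    tendsto_neg_atTop_atBot.mono_right atBot_le_cocompact
  have h3 := h.comp h2
  have h4 : Tendsto (fun y => ((∫ u, hF u * (T * fej (T * (u - y))) : ℝ) : ℂ)) atTop (𝓝 0) := by
    refine h3.congr fun y => ?_
    rw [key2 hT y, Function.comp_apply, Real.fourier_real_eq_integral_exp_smul]
    refine integral_congr_ae (Eventually.of_forall fun t => ?_)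
    simp only [smul_eq_mul]
    rw [mul_left_comm]
    congr 3
    push_cast; ring
  have := (Complex.continuous_re.tendsto 0).comp h4
  simpa using! this

lemma psi_upper {ε : ℝ} (hε : 0 < ε) : ∀ᶠ x : ℝ in atTop, Chebyshev.psi x ≤ (1 + ε) * x := by
  set I := ∫ v, fej v with hI
  have hIpos : 0 < I := integral_fej_pos
  -- choose η
  obtain ⟨η, hη, hη2⟩ : ∃ η > 0, Real.exp (2 * η) < 1 + ε := by
    have hc : Tendsto (fun η : ℝ => Real.exp (2 * η)) (𝓝[>] 0) (𝓝 1) := by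
      have : Continuous (fun η : ℝ => Real.exp (2 * η)) := by fun_prop
      have := (this.tendsto 0).mono_left (nhdsWithin_le_nhds (s := Set.Ioi 0))
      simpa using this
    have := (hc.eventually (gt_mem_nhds (show (1:ℝ) < 1 + ε by linarith))).and self_mem_nhdsWithin
    obtain ⟨η, h1, h2⟩ := this.exists
    exact ⟨η, h2, h1⟩
  have hlim : Tendsto (fun R : ℝ => Real.exp (-(2 * η)) * (1 + ε) * ∫ v in -R..R, fej v) atTop
      (𝓝 (Real.exp (-(2 * η)) * (1 + ε) * I)) :=
    (intervalIntegral_tendsto_integral integrable_fej tendsto_neg_atTop_atBot tendsto_id).const_mul _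
  have hgt : I < Real.exp (-(2 * η)) * (1 + ε) * I := by
    have : 1 < Real.exp (-(2 * η)) * (1 + ε) := by
      rw [Real.exp_neg, ← div_eq_inv_mul, lt_div_iff₀ (Real.exp_pos _), one_mul]; exact hη2
    nlinarith
  obtain ⟨R, hR1, hR2⟩ := ((hlim.eventually (lt_mem_nhds hgt)).and (eventually_gt_atTop 0)).exists
  set J := ∫ v in -R..R, fej v with hJ
  set T := R / η with hTdef
  have hT : 0 < T := div_pos hR2 hη
  have hd : 0 < Real.exp (-(2 * η)) * (1 + ε) * J - I := by linarith
  have hev := (key3 hT).eventually (gt_mem_nhds hd)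
  have hA : ∀ᶠ y : ℝ in atTop, aF (y - η) ≤ 1 + ε := by
    filter_upwards [hev] with y hy
    have iF := integrable_fejT hT y
    have ia : Integrable (fun u => aF u * (T * fej (T * (u - y)))) :=
      iF.bdd_mul (c := CC) measurable_aF.aestronglyMeasurable (Eventually.of_forall fun u => by
        rw [Real.norm_of_nonneg (aF_nonneg u)]; exact aF_le u)
    have ih : Integrable (fun u => hF u * (T * fej (T * (u - y)))) :=
      iF.bdd_mul (c := CC + 1) measurable_hF.aestronglyMeasurable (Eventually.of_forall fun u => by
        rw [Real.norm_eq_abs]; exact abs_hF_le u)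
    have hpos : ∀ u, 0 ≤ T * fej (T * (u - y)) := fun u => mul_nonneg hT.le (fej_nonneg _)
    have hIT : ∫ u, T * fej (T * (u - y)) = I := by
      rw [integral_sub_right_eq_self (fun u => T * fej (T * u)) y, integral_const_mul,
        Measure.integral_comp_mul_left, abs_of_pos (inv_pos.2 hT), smul_eq_mul,
        ← mul_assoc, mul_inv_cancel₀ hT.ne', one_mul]
    have hJT : ∫ u in (y - η)..(y + η), T * fej (T * (u - y)) = J := by
      rw [intervalIntegral.integral_comp_sub_right (fun u => T * fej (T * u)) y,
        intervalIntegral.integral_const_mul, intervalIntegral.mul_integral_comp_mul_left]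
      have : T * η = R := by rw [hTdef]; field_simp
      rw [hJ]; congr 1 <;> ring_nf <;> linarith
    have h1 : ∫ u, aF u * (T * fej (T * (u - y))) ≤
        (∫ u, hF u * (T * fej (T * (u - y)))) + I := by
      rw [← hIT, ← integral_add ih iF]
      refine integral_mono ia (ih.add iF) fun u => ?_
      have : aF u ≤ hF u + 1 := by
        unfold hF
        by_cases h : u ∈ Set.Ioi (0:ℝ) <;> simp [h]
      have := mul_le_mul_of_nonneg_right this (hpos u)
      simp only
      linarith
    have h2 : aF (y - η) * Real.exp (-(2 * η)) * J ≤ ∫ u, aF u * (T * fej (T * (u - y))) := by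
      have : ∫ u in (y - η)..(y + η), aF u * (T * fej (T * (u - y))) ≤
          ∫ u, aF u * (T * fej (T * (u - y))) := by
        rw [intervalIntegral.integral_of_le (by linarith)]
        exact setIntegral_le_integral ia (Eventually.of_forall fun u => mul_nonneg (aF_nonneg u) (hpos u))
      refine le_trans ?_ this
      rw [← hJT, ← intervalIntegral.integral_const_mul]
      refine intervalIntegral.integral_mono_on (by linarith) (iF.intervalIntegrable.const_mul _)
        ia.intervalIntegrable fun u hu => ?_
      refine mul_le_mul_of_nonneg_right ?_ (hpos u)
      unfold aF
      rw [mul_assoc, ← Real.exp_add]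
      have hu1 := hu.1
      have hu2 := hu.2
      exact mul_le_mul (Chebyshev.psi_mono (Real.exp_le_exp.2 hu1))
        (Real.exp_le_exp.2 (by linarith)) (Real.exp_pos _).le (Chebyshev.psi_nonneg _)
    have h3 : aF (y - η) * (Real.exp (-(2 * η)) * J) < (1 + ε) * (Real.exp (-(2 * η)) * J) := by
      linarith
    have hJpos : 0 < Real.exp (-(2 * η)) * J := by
      have : 0 < (1 + ε) * (Real.exp (-(2 * η)) * J) := by linarith
      exact (pos_iff_pos_of_mul_pos this).1 (by linarith)
    exact (lt_of_mul_lt_mul_right h3 hJpos.le).le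
  have htend : Tendsto (fun x : ℝ => Real.log x + η) atTop atTop :=
    tendsto_atTop_add_const_right _ _ Real.tendsto_log_atTop
  filter_upwards [htend.eventually hA, eventually_gt_atTop 0] with x hx hx0
  rw [add_sub_cancel_right, aF, Real.exp_neg, Real.exp_log hx0, ← div_eq_mul_inv,
    div_le_iff₀ hx0] at hx
  exact hx

lemma pi_upper {ε : ℝ} (hε : 0 < ε) :
    ∀ᶠ x : ℝ in atTop, ((primesUpTo x).card : ℝ) ≤ (1 + ε) * (x / Real.log x) := by
  have h := Chebyshev.integral_theta_div_log_sq_isLittleO.bound (half_pos hε)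
  filter_upwards [eventually_ge_atTop 2, h, psi_upper (half_pos hε)] with x hx h1 h2
  have hcard : (primesUpTo x).card = Nat.primeCounting ⌊x⌋₊ := by
    rw [← Nat.primesLE_card_eq_primeCounting]
    congr 1
    ext p
    simp [primesUpTo, Nat.mem_primesLE]
  rw [hcard, Chebyshev.primeCounting_eq_theta_div_log_add_integral hx]
  have hl : 0 < Real.log x := Real.log_pos (by linarith)
  have hq : 0 ≤ x / Real.log x := by positivity
  rw [Real.norm_of_nonneg hq] at h1
  have h3 := (Real.le_norm_self _).trans h1
  have h4 : Chebyshev.theta x / Real.log x ≤ (1 + ε / 2) * (x / Real.log x) := by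
    rw [← mul_div_assoc]
    exact div_le_div_of_nonneg_right ((Chebyshev.theta_le_psi x).trans h2) hl.le
  linarith
end SC

/-- Main theorem (analytic content of Theorem 3.3): under Weissauer's bound, the asymptotic
for `∑ λF(p)²`, the `o(x/log x)` bound for `∑ λF(p)·λG(p)`, and the counting hypothesis for
`|λG(p)| > c`, with `16α + m − 16 > 0`, the set of primes with `λF(p)·λG(p) < 0` satisfies
`liminf (log x / x) · #{p ≤ x : λF(p)·λG(p) < 0} ≥ c²·(16α + m − 16)/512 > 0`; in
particular this set of primes has positive lower density among the primes. -/
theorem sign_change_main (lamF lamG : ℕ → ℝ) (S : Finset ℕ)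
    (hS : ∀ p ∈ S, Nat.Prime p) (m : ℝ) (hm : 0 < m)
    (c : ℝ) (hc : c ∈ Set.Ioo (0 : ℝ) 4) (α : ℝ) (hα : 0 < 16 * α + m - 16)
    (hF : ∀ p : ℕ, Nat.Prime p → p ∉ S → |lamF p| ≤ 4)
    (hG : ∀ p : ℕ, Nat.Prime p → p ∉ S → |lamG p| ≤ 4)
    (hsum : (fun x : ℝ =>
        (∑ p ∈ (primesUpTo x).filter (fun p => p ∉ S), (lamF p) ^ 2) -
          m * (x / Real.log x))
      =o[atTop] (fun x : ℝ => x / Real.log x))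
    (hprod : (fun x : ℝ =>
        ∑ p ∈ (primesUpTo x).filter (fun p => p ∉ S), lamF p * lamG p)
      =o[atTop] (fun x : ℝ => x / Real.log x))
    (hcount : ∀ᶠ x : ℝ in atTop,
      α * (x / Real.log x) ≤ ((primesUpTo x).filter (fun p => c < |lamG p|)).card) :
    (c ^ 2 * (16 * α + m - 16) / 512 ≤
      Filter.liminf
        (fun x : ℝ => (Real.log x / x) *
          ((primesUpTo x).filter (fun p => lamF p * lamG p < 0)).card)
        atTop) ∧
    0 < c ^ 2 * (16 * α + m - 16) / 512 ∧
    0 < Filter.liminf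
        (fun x : ℝ =>
          (((primesUpTo x).filter (fun p => lamF p * lamG p < 0)).card : ℝ) /
            ((primesUpTo x).card : ℝ))
        atTop := by
  have hc0 : 0 < c := hc.1
  have hc4 : c < 4 := hc.2
  set κ := 16 * α + m - 16 with hκ
  have hD : 0 < c ^ 2 * κ / 512 := by positivity
  set N : ℝ → ℝ := fun x => (((primesUpTo x).filter (fun p => lamF p * lamG p < 0)).card : ℝ) with hN
  set ε := c * κ * (4 - c) / 512 with hε
  have hεpos : 0 < ε := by
    have : 0 < 4 - c := by linarith
    positivity
  have hpos : ∀ᶠ x : ℝ in atTop, 0 < x / Real.log x := by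
    filter_upwards [eventually_gt_atTop 1] with x hx
    have := Real.log_pos hx
    positivity
  have hlow : ∀ᶠ x : ℝ in atTop, c ^ 2 * κ / 512 * (x / Real.log x) ≤ N x := by
    filter_upwards [hpos, hsum.bound hεpos, hprod.bound hεpos, hcount, SC.pi_upper hεpos]
      with x hX h1 h2 h3 h4
    set X := x / Real.log x with hXdef
    rw [Real.norm_of_nonneg hX.le] at h1 h2
    replace h1 := (abs_le.1 h1).1
    replace h2 := (abs_le.1 h2).2
    set P := primesUpTo x with hP
    set P' := P.filter (fun p => p ∉ S) with hP'
    have hpt : ∀ p ∈ P', c / 4 * (lamF p ^ 2 - 16 * (if ¬ c < |lamG p| then 1 else 0)) ≤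
        lamF p * lamG p + 32 * (if lamF p * lamG p < 0 then 1 else 0) := by
      intro p hp
      rw [hP', Finset.mem_filter, hP, primesUpTo, Finset.mem_filter] at hp
      have ha := hF p hp.1.2 hp.2
      have hb := hG p hp.1.2 hp.2
      have hab : |lamF p * lamG p| ≤ lamF p * lamG p + 32 * (if lamF p * lamG p < 0 then 1 else 0) := by
        split_ifs with h
        · have : |lamF p * lamG p| ≤ 16 := by
            rw [abs_mul]; nlinarith [abs_nonneg (lamF p), abs_nonneg (lamG p)]
          have := (abs_le.1 this).1
          rw [abs_of_neg h]; linarith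
        · rw [abs_of_nonneg (not_lt.1 h)]; linarith
      refine le_trans ?_ hab
      rw [abs_mul, ← sq_abs]
      have h0 := abs_nonneg (lamF p)
      have h0' := abs_nonneg (lamG p)
      have hsq : |lamF p| ^ 2 ≤ 4 * |lamF p| := by nlinarith
      split_ifs with h
      · have h5 : c / 4 * |lamF p| ^ 2 ≤ c / 4 * (4 * |lamF p|) :=
          mul_le_mul_of_nonneg_left hsq (by positivity)
        have h6 : c * |lamF p| ≤ |lamG p| * |lamF p| :=
          mul_le_mul_of_nonneg_right h.le h0
        linarith
      · have : |lamF p| ^ 2 - 16 * 1 ≤ 0 := by nlinarith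
        have h5 : c / 4 * (|lamF p| ^ 2 - 16 * 1) ≤ 0 :=
          mul_nonpos_of_nonneg_of_nonpos (by positivity) this
        have : 0 ≤ |lamF p| * |lamG p| := by positivity
        linarith
    have hs := Finset.sum_le_sum hpt
    rw [← Finset.mul_sum, Finset.sum_sub_distrib, ← Finset.mul_sum, Finset.sum_add_distrib,
      ← Finset.mul_sum, Finset.sum_boole, Finset.sum_boole] at hs
    have hn1 : ((P'.filter (fun p => lamF p * lamG p < 0)).card : ℝ) ≤ N x := by
      simp only [hN]
      exact_mod_cast Finset.card_le_card (Finset.filter_subset_filter _ (Finset.filter_subset _ _))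
    have hn2 : ((P'.filter (fun p => ¬ c < |lamG p|)).card : ℝ) ≤ (1 + ε) * X - α * X := by
      have e1 : ((P'.filter (fun p => ¬ c < |lamG p|)).card : ℝ) ≤
          ((P.filter (fun p => ¬ c < |lamG p|)).card : ℝ) := by
        exact_mod_cast Finset.card_le_card (Finset.filter_subset_filter _ (Finset.filter_subset _ _))
      have e2 : ((P.filter (fun p => c < |lamG p|)).card : ℝ) +
          ((P.filter (fun p => ¬ c < |lamG p|)).card : ℝ) = (P.card : ℝ) := by
        exact_mod_cast Finset.card_filter_add_card_filter_not (s := P) (fun p => c < |lamG p|)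
      linarith
    have h5 : c / 4 * ((m - ε) * X - 16 * ((1 + ε) * X - α * X)) ≤ ε * X + 32 * N x := by
      refine le_trans (mul_le_mul_of_nonneg_left ?_ (by positivity)) (hs.trans ?_) <;> linarith
    have h6 : c / 4 * ((m - ε) * X - 16 * ((1 + ε) * X - α * X)) =
        (c / 4 * κ - 17 * (c * ε) / 4) * X := by rw [hκ]; ring
    rw [h6] at h5
    have h7 : c * ε ≤ 4 * ε := mul_le_mul_of_nonneg_right hc4.le hεpos.le
    have h8 : c ^ 2 * κ / 512 * 32 ≤ c / 4 * κ - 17 * (c * ε) / 4 - ε := by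
      have : c / 4 * κ - c ^ 2 * κ / 512 * 32 = 32 * ε := by rw [hε]; ring
      linarith
    have h9 := mul_le_mul_of_nonneg_right h8 hX.le
    linarith
  have hup := SC.pi_upper one_pos
  have hNP : ∀ x, N x ≤ ((primesUpTo x).card : ℝ) := fun x => by
    simp only [hN]
    exact_mod_cast Finset.card_le_card (Finset.filter_subset _ _)
  refine ⟨?_, hD, ?_⟩
  · refine le_liminf_of_le ?_ ?_
    · refine IsBoundedUnder.isCoboundedUnder_ge ⟨2, ?_⟩
      rw [eventually_map]
      filter_upwards [hpos, hup] with x hX h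
      have h1 : Real.log x / x = (x / Real.log x)⁻¹ := by rw [inv_div]
      rw [h1, ← div_eq_inv_mul, div_le_iff₀ hX]
      linarith [hNP x]
    · filter_upwards [hpos, hlow] with x hX h
      have h1 : Real.log x / x = (x / Real.log x)⁻¹ := by rw [inv_div]
      rw [h1, ← div_eq_inv_mul, le_div_iff₀ hX]
      exact h
  · refine lt_of_lt_of_le (half_pos hD) (le_liminf_of_le ?_ ?_)
    · refine IsBoundedUnder.isCoboundedUnder_ge ⟨1, ?_⟩
      rw [eventually_map]
      exact Eventually.of_forall fun x => div_le_one_of_le₀ (hNP x) (Nat.cast_nonneg _)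
    · filter_upwards [hpos, hlow, hup] with x hX h h'
      have hp : 0 < ((primesUpTo x).card : ℝ) :=
        lt_of_lt_of_le (mul_pos hD hX) (h.trans (hNP x))
      rw [le_div_iff₀ hp]
      refine le_trans ?_ h
      have := mul_le_mul_of_nonneg_left h' (half_pos hD).le
      linarith
end
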